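/- There exists a divisible design Cayley graph with parameters (24, 7, 0, 2, 8, 3); that is, a simple graph on 24 vertices that is simultaneously a divisible design graph with parameters (24, 7, 0, 2, 8, 3) and a Cayley graph. -/

import Mathlib

/-- A divisible design graph (DDG) with parameters `(v, k, l1, l2, m, n)`:
a `k`-regular simple graph on `v = m * n` vertices whose vertex set can be partitioned
into `m` classes of size `n` such that two distinct vertices from the same class have
exactly `l1` common neighbours and two vertices from different classes have exactly `l2`
common neighbours. -/
def IsDDG {V : Type*} (Γ : SimpleGraph V) (v k l1 l2 m n : ℕ) : Prop :=
  Nat.card V = v ∧ v = m * n ∧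
  (∀ x : V, Nat.card {z : V // Γ.Adj x z} = k) ∧
  ∃ c : V → Fin m,
    (∀ i : Fin m, Nat.card {x : V // c x = i} = n) ∧
    (∀ x y : V, x ≠ y → c x = c y →
      Nat.card {z : V // Γ.Adj x z ∧ Γ.Adj y z} = l1) ∧
    (∀ x y : V, c x ≠ c y →
      Nat.card {z : V // Γ.Adj x z ∧ Γ.Adj y z} = l2)

/-- A simple graph is a Cayley graph if and only if its automorphism group contains a
subgroup acting regularly (sharply transitively) on the vertices. -/
def IsCayleyGraph {V : Type*} (Γ : SimpleGraph V) : Prop :=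
  ∃ H : Subgroup (Equiv.Perm V),
    (∀ g ∈ H, ∀ x y : V, Γ.Adj (g x) (g y) ↔ Γ.Adj x y) ∧
    ∀ x y : V, ∃! g : Equiv.Perm V, g ∈ H ∧ g x = y

open Equiv in
/-- An inverse-closed connection set of size `7` in the symmetric group on four points. -/
def connectionSet : Finset (Perm (Fin 4)) :=
  {swap 2 3, swap 1 2, swap 0 2 * swap 1 3, swap 0 2 * swap 2 3,
    swap 0 3 * swap 3 2, swap 0 2 * swap 2 1 * swap 1 3,
    swap 0 3 * swap 3 1 * swap 1 2}

/-- The Cayley graph of a group with respect to an inverse-closed set without the identity. -/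
def cayleyGraph {G : Type*} [Group G] (S : Finset G) (h1 : 1 ∉ S)
    (hinv : ∀ s ∈ S, s⁻¹ ∈ S) : SimpleGraph G where
  Adj x y := x⁻¹ * y ∈ S
  symm := ⟨fun x y h => by simpa using hinv _ h⟩
  loopless := ⟨fun x h => h1 (by simpa using h)⟩

section cayleyGraph

variable {G : Type*} [Group G] {S : Finset G} {h1 : 1 ∉ S} {hinv : ∀ s ∈ S, s⁻¹ ∈ S}

theorem isCayleyGraph_cayleyGraph : IsCayleyGraph (cayleyGraph S h1 hinv) := by
  refine ⟨(MulAction.toPermHom G G).range, ?_, fun x y => ?_⟩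
  · rintro _ ⟨g, rfl⟩ x y
    simp [cayleyGraph, mul_assoc]
  · refine ⟨MulAction.toPermHom G G (y * x⁻¹), ⟨⟨_, rfl⟩, by simp⟩, ?_⟩
    rintro _ ⟨⟨g, rfl⟩, hg⟩
    have hgy : g * x = y := hg
    rw [← hgy, mul_inv_cancel_right]

theorem card_adj_cayleyGraph (x : G) :
    Nat.card {z : G // (cayleyGraph S h1 hinv).Adj x z} = S.card := by
  rw [← Nat.card_eq_finsetCard]
  exact Nat.card_congr ((Equiv.mulLeft x⁻¹).subtypeEquiv fun z => Iff.rfl)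

theorem card_common_adj_cayleyGraph [DecidableEq G] (x y : G) :
    Nat.card {z : G // (cayleyGraph S h1 hinv).Adj x z ∧ (cayleyGraph S h1 hinv).Adj y z} =
      (S.filter fun s => (x⁻¹ * y)⁻¹ * s ∈ S).card := by
  rw [← Nat.card_eq_finsetCard]
  refine Nat.card_congr ((Equiv.mulLeft x⁻¹).subtypeEquiv fun z => ?_)
  simp [cayleyGraph, mul_assoc]

end cayleyGraph

/-- The index of the left coset of the subgroup generated by the `3`-cycle `(0 1 2)` that
contains `x`, which is determined by `x 3` and the sign of `x`. -/
def cosetIndex (x : Equiv.Perm (Fin 4)) : Fin 8 :=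
  finProdFinEquiv (m := 4) (n := 2) (x 3, if Equiv.Perm.sign x = 1 then 0 else 1)

theorem cosetIndex_eq_iff (x y : Equiv.Perm (Fin 4)) :
    cosetIndex x = cosetIndex y ↔ cosetIndex (x⁻¹ * y) = cosetIndex 1 := by
  revert x y
  decide +kernel

theorem card_cosetIndex_fiber (i : Fin 8) :
    Nat.card {x : Equiv.Perm (Fin 4) // cosetIndex x = i} = 3 := by
  rw [Nat.card_eq_fintype_card]
  revert i
  decide +kernel

theorem card_connectionSet_inter_translate (g : Equiv.Perm (Fin 4)) (hg : g ≠ 1) :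
    (connectionSet.filter fun s => g⁻¹ * s ∈ connectionSet).card =
      if cosetIndex g = cosetIndex 1 then 0 else 2 := by
  revert g
  decide +kernel


/-- There exists a divisible design Cayley graph with parameters
`(24, 7, 0, 2, 8, 3)`. -/
theorem exists_ddcg_24_7_0_2_8_3 :
    ∃ (V : Type) (Γ : SimpleGraph V),
        IsDDG Γ 24 7 0 2 8 3 ∧ IsCayleyGraph Γ := by
  refine ⟨Equiv.Perm (Fin 4), cayleyGraph connectionSet (by decide +kernel) (by decide +kernel),
    ⟨?_, rfl, fun x => ?_, cosetIndex, card_cosetIndex_fiber, fun x y hne hxy => ?_,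
      fun x y hxy => ?_⟩, isCayleyGraph_cayleyGraph⟩
  · rw [Nat.card_perm, Nat.card_fin]
    rfl
  · rw [card_adj_cayleyGraph]
    decide +kernel
  · have h : x⁻¹ * y ≠ 1 := fun h => hne (inv_mul_eq_one.mp h)
    rw [card_common_adj_cayleyGraph, card_connectionSet_inter_translate _ h,
      if_pos ((cosetIndex_eq_iff x y).mp hxy)]
  · have h : x⁻¹ * y ≠ 1 := fun h => hxy (congrArg cosetIndex (inv_mul_eq_one.mp h))
    rw [card_common_adj_cayleyGraph, card_connectionSet_inter_translate _ h,
      if_neg fun hc => hxy ((cosetIndex_eq_iff x y).mpr hc)]
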